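/- Let P and Q be isogonal conjugate points in triangle ABC, let A₁, B₁, C₁ be points on lines BC, CA, AB such that P is the Miquel point of triangle A₁B₁C₁ in ABC, and let A₂, B₂, C₂ be points on lines BC, CA, AB satisfying the directed angle conditions ∡PA₁A₂ = −∡QA₂A₁, ∡PB₁B₂ = −∡QB₂B₁, ∡PC₁C₂ = −∡QC₂C₁ (so that Q is the Miquel point of A₂B₂C₂). Then the six points A₁, A₂, B₁, B₂, C₁, C₂ lie on a single circle. -/

import Mathlib

open EuclideanGeometry

noncomputable local instance : Module.Oriented ℝ ℂ (Fin 2) := ⟨Complex.orientation⟩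
local instance : Fact (Module.finrank ℝ ℂ = 2) := ⟨Complex.finrank_real_complex⟩

/-- The signed area of the parallelogram spanned by `z` and `w`. -/
def cross (z w : ℂ) : ℝ := z.re * w.im - z.im * w.re

/-- The real inner product of `z` and `w`, in coordinates. -/
def dot (z w : ℂ) : ℝ := z.re * w.re + z.im * w.im

theorem oangle_eq_arg (X Y Z : ℂ) :
    ∡ X Y Z = (Complex.arg (starRingEnd ℂ (X - Y) * (Z - Y)) : Real.Angle) :=
  Complex.oangle _ _

theorem im_conj_mul (z w : ℂ) : (starRingEnd ℂ z * w).im = cross z w := by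
  simp [cross]; ring

theorem re_conj_mul (z w : ℂ) : (starRingEnd ℂ z * w).re = dot z w := by
  simp [dot]

theorem norm_mul_sin_oangle (X Y Z : ℂ) :
    ‖starRingEnd ℂ (X - Y) * (Z - Y)‖ * (∡ X Y Z).sin = cross (X - Y) (Z - Y) := by
  rw [oangle_eq_arg, Real.Angle.sin_coe, Complex.norm_mul_sin_arg, im_conj_mul]

theorem norm_mul_cos_oangle (X Y Z : ℂ) :
    ‖starRingEnd ℂ (X - Y) * (Z - Y)‖ * (∡ X Y Z).cos = dot (X - Y) (Z - Y) := by
  rw [oangle_eq_arg, Real.Angle.cos_coe, Complex.norm_mul_cos_arg, re_conj_mul]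

theorem sin_oangle_eq_zero_iff (X Y Z : ℂ) :
    (∡ X Y Z).sin = 0 ↔ cross (X - Y) (Z - Y) = 0 := by
  rw [← norm_mul_sin_oangle, mul_eq_zero]
  refine ⟨Or.inr, fun h => h.elim (fun h0 => ?_) id⟩
  rw [oangle_eq_arg, norm_eq_zero.1 h0]
  simp

theorem two_zsmul_angle_eq {θ ψ : Real.Angle} (h : (2 : ℤ) • θ = (2 : ℤ) • ψ) :
    θ.sin * ψ.cos = θ.cos * ψ.sin ∧ (θ.sin = 0 ↔ ψ.sin = 0) := by
  rcases Real.Angle.two_zsmul_eq_iff.1 h with rfl | rfl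
  · exact ⟨mul_comm _ _, Iff.rfl⟩
  · simp [Real.Angle.sin_add_pi, Real.Angle.cos_add_pi, mul_comm]

theorem cross_mul_dot_of_two_zsmul_oangle_eq {X Y Z U V W : ℂ}
    (h : (2 : ℤ) • ∡ X Y Z = (2 : ℤ) • ∡ U V W) :
    cross (X - Y) (Z - Y) * dot (U - V) (W - V) =
      dot (X - Y) (Z - Y) * cross (U - V) (W - V) := by
  rw [← norm_mul_sin_oangle, ← norm_mul_sin_oangle, ← norm_mul_cos_oangle, ← norm_mul_cos_oangle]
  linear_combination ‖starRingEnd ℂ (X - Y) * (Z - Y)‖ * ‖starRingEnd ℂ (U - V) * (W - V)‖ *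
    (two_zsmul_angle_eq h).1

theorem cross_eq_zero_iff_of_two_zsmul_oangle_eq {X Y Z U V W : ℂ}
    (h : (2 : ℤ) • ∡ X Y Z = (2 : ℤ) • ∡ U V W) :
    cross (X - Y) (Z - Y) = 0 ↔ cross (U - V) (W - V) = 0 := by
  rw [← sin_oangle_eq_zero_iff, ← sin_oangle_eq_zero_iff]
  exact (two_zsmul_angle_eq h).2

theorem cross_mul_dot_of_two_zsmul_oangle_eq_neg {X Y Z U V W : ℂ}
    (h : (2 : ℤ) • ∡ X Y Z = -((2 : ℤ) • ∡ U V W)) :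
    cross (X - Y) (Z - Y) * dot (U - V) (W - V) =
      -(dot (X - Y) (Z - Y) * cross (U - V) (W - V)) := by
  rw [← smul_neg, ← oangle_rev] at h
  have := cross_mul_dot_of_two_zsmul_oangle_eq h
  simp only [cross, dot] at this ⊢
  linear_combination this

theorem cross_ne_zero_of_affineIndependent {A B C : ℂ} (h : AffineIndependent ℝ ![A, B, C]) :
    cross (C - B) (A - B) ≠ 0 := by
  intro h0
  refine affineIndependent_iff_not_collinear_set.1 h
    (oangle_sign_eq_zero_iff_collinear.1 ?_)
  have : cross (A - B) (C - B) = 0 := by simp only [cross] at h0 ⊢; linear_combination -h0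
  rw [Real.Angle.sign, (sin_oangle_eq_zero_iff A B C).2 this, sign_zero]

theorem exists_eq_add_of_mem_line {X B C : ℂ} (h : X ∈ line[ℝ, B, C]) :
    ∃ k : ℝ, X.re = B.re + k * (C.re - B.re) ∧ X.im = B.im + k * (C.im - B.im) := by
  obtain ⟨k, rfl⟩ := mem_affineSpan_pair_iff_exists_lineMap_eq.1 h
  exact ⟨k, by simp [AffineMap.lineMap_apply]; ring, by simp [AffineMap.lineMap_apply]; ring⟩

theorem dot_eq_of_dist_eq {O X Y : ℂ} (h : dist X O = dist Y O) :
    dot (X - Y) (X - Y) = 2 * dot (O - Y) (X - Y) := by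
  rw [Complex.dist_eq, Complex.dist_eq] at h
  have h2 : ‖X - O‖ ^ 2 = ‖Y - O‖ ^ 2 := by rw [h]
  rw [Complex.sq_norm, Complex.sq_norm, Complex.normSq_apply, Complex.normSq_apply] at h2
  simp only [dot, Complex.sub_re, Complex.sub_im] at h2 ⊢
  linear_combination h2

/-- A circle through `A` which meets `CA`, `AB` again at `Y`, `Z`, as a condition on a further
point `P` of it. -/
theorem cross_mul_dot_self_of_cospherical {A B C Y Z P : ℂ}
    (hY : Y ∈ line[ℝ, C, A]) (hZ : Z ∈ line[ℝ, A, B]) (hYA : Y ≠ A) (hZA : Z ≠ A)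
    (h : Cospherical ({A, Y, Z, P} : Set ℂ)) :
    cross (B - A) (C - A) * dot (P - A) (P - A) =
      cross (P - A) (C - A) * dot (Z - A) (B - A) +
        cross (B - A) (P - A) * dot (Y - A) (C - A) := by
  obtain ⟨O, r, hO⟩ := h
  have hA : dist A O = r := hO A (by simp)
  have eP := dot_eq_of_dist_eq ((hO P (by simp)).trans hA.symm)
  have eY := dot_eq_of_dist_eq ((hO Y (by simp)).trans hA.symm)
  have eZ := dot_eq_of_dist_eq ((hO Z (by simp)).trans hA.symm)
  obtain ⟨y, hy1, hy2⟩ := exists_eq_add_of_mem_line hY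
  obtain ⟨z, hz1, hz2⟩ := exists_eq_add_of_mem_line hZ
  have hy : 1 - y ≠ 0 := by
    intro h0
    apply hYA
    apply Complex.ext
    · rw [hy1]; linear_combination -(A.re - C.re) * h0
    · rw [hy2]; linear_combination -(A.im - C.im) * h0
  have hz : z ≠ 0 := by
    rintro rfl
    apply hZA
    apply Complex.ext
    · rw [hz1]; ring
    · rw [hz2]; ring
  have eY' : dot (Y - A) (C - A) = 2 * dot (O - A) (C - A) := by
    apply mul_left_cancel₀ hy
    simp only [dot, Complex.sub_re, Complex.sub_im, hy1, hy2] at eY ⊢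
    linear_combination eY
  have eZ' : dot (Z - A) (B - A) = 2 * dot (O - A) (B - A) := by
    apply mul_left_cancel₀ hz
    simp only [dot, Complex.sub_re, Complex.sub_im, hz1, hz2] at eZ ⊢
    linear_combination eZ
  rw [eP, eY', eZ']
  simp only [dot, cross]
  ring

theorem dot_self_ne_zero {z : ℂ} (h : z ≠ 0) : dot z z ≠ 0 := by
  rw [dot, ← Complex.normSq_apply]
  exact fun h0 => h (Complex.normSq_eq_zero.1 h0)

theorem eq_of_cross_eq_zero {A X v w : ℂ} (h : cross v w ≠ 0)
    (hv : cross v (X - A) = 0) (hw : cross w (X - A) = 0) : X = A := by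
  simp only [cross, Complex.sub_re, Complex.sub_im] at hv hw h
  apply Complex.ext
  · apply mul_left_cancel₀ h
    linear_combination w.re * hv - v.re * hw
  · apply mul_left_cancel₀ h
    linear_combination w.im * hv - v.im * hw

theorem ne_vertex_of_cospherical {A B C Y Z P : ℂ} (hABC : cross (C - B) (A - B) ≠ 0)
    (hY : Y ∈ line[ℝ, C, A]) (hZ : Z ∈ line[ℝ, A, B]) (hYA : Y ≠ A) (hZA : Z ≠ A)
    (hYC : Y ≠ C) (hZB : Z ≠ B) (h : Cospherical ({A, Y, Z, P} : Set ℂ)) : P ≠ B ∧ P ≠ C := by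
  have key := cross_mul_dot_self_of_cospherical hY hZ hYA hZA h
  obtain ⟨y, hy1, hy2⟩ := exists_eq_add_of_mem_line hY
  obtain ⟨z, hz1, hz2⟩ := exists_eq_add_of_mem_line hZ
  have hBA : B - A ≠ 0 := by
    intro h0
    apply hABC
    rw [sub_eq_zero.1 h0]
    simp [cross]
  have hCA : C - A ≠ 0 := by
    intro h0
    apply hABC
    rw [sub_eq_zero.1 h0, cross]
    ring
  constructor
  · rintro rfl
    have : z - 1 = 0 := by
      apply mul_left_cancel₀ (mul_ne_zero hABC (dot_self_ne_zero hBA))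
      simp only [cross, dot, Complex.sub_re, Complex.sub_im, hz1, hz2] at key ⊢
      linear_combination -key
    apply hZB
    apply Complex.ext
    · rw [hz1]; linear_combination (P.re - A.re) * this
    · rw [hz2]; linear_combination (P.im - A.im) * this
  · rintro rfl
    have : y = 0 := by
      apply mul_left_cancel₀ (mul_ne_zero hABC (dot_self_ne_zero hCA))
      simp only [cross, dot, Complex.sub_re, Complex.sub_im, hy1, hy2] at key ⊢
      linear_combination key
    apply hYC
    apply Complex.ext
    · rw [hy1, this]; ring
    · rw [hy2, this]; ring

theorem cross_ne_zero_of_isogonal {A B C P Q : ℂ} (hABC : cross (C - B) (A - B) ≠ 0)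
    (h₁ : (2 : ℤ) • ∡ P A B = (2 : ℤ) • ∡ C A Q)
    (h₂ : (2 : ℤ) • ∡ P B C = (2 : ℤ) • ∡ A B Q)
    (h₃ : (2 : ℤ) • ∡ P C A = (2 : ℤ) • ∡ B C Q)
    (hPB : P ≠ B) (hPC : P ≠ C) : cross (C - B) (P - B) ≠ 0 := by
  intro h0
  have hCB : dot (C - B) (C - B) ≠ 0 := by
    refine dot_self_ne_zero fun h => hABC ?_
    rw [h]; simp [cross]
  have hP0 : dot (P - C) (P - C) ≠ 0 := dot_self_ne_zero (sub_ne_zero.2 hPC)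
  have hQAB : cross (A - B) (Q - B) = 0 := by
    refine (cross_eq_zero_iff_of_two_zsmul_oangle_eq h₂).1 ?_
    simp only [cross] at h0 ⊢
    linear_combination -h0
  have hQCA : cross (A - C) (Q - C) = 0 := by
    have e := cross_mul_dot_of_two_zsmul_oangle_eq h₃
    have hd : dot (P - C) (C - B) ≠ 0 := by
      intro hd
      have : dot (C - B) (C - B) * dot (P - C) (P - C) = 0 := by
        simp only [cross, dot, Complex.sub_re, Complex.sub_im] at h0 hd ⊢
        linear_combination ((P.re - C.re) * (C.re - B.re) + (P.im - C.im) * (C.im - B.im)) * hd +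
          ((C.re - B.re) * (P.im - B.im) - (C.im - B.im) * (P.re - B.re)) * h0
      exact (mul_ne_zero hCB hP0) this
    apply mul_left_cancel₀ hd
    simp only [cross, dot, Complex.sub_re, Complex.sub_im] at h0 e ⊢
    linear_combination e - ((Q.re - C.re) * (A.re - C.re) + (Q.im - C.im) * (A.im - C.im)) * h0
  have hAX : cross (A - B) (A - C) ≠ 0 := by
    intro h; apply hABC
    simp only [cross, Complex.sub_re, Complex.sub_im] at h ⊢
    linear_combination h
  have hQA : Q = A := by
    refine eq_of_cross_eq_zero hAX ?_ ?_
    · simp only [cross, Complex.sub_re, Complex.sub_im] at hQAB ⊢; linear_combination hQAB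
    · simp only [cross, Complex.sub_re, Complex.sub_im] at hQCA ⊢; linear_combination hQCA
  have hPAB : cross (P - A) (B - A) = 0 := by
    refine (cross_eq_zero_iff_of_two_zsmul_oangle_eq h₁).2 ?_
    rw [hQA]; simp [cross]
  refine hPB (eq_of_cross_eq_zero hABC h0 ?_)
  simp only [cross, Complex.sub_re, Complex.sub_im] at hPAB ⊢
  linear_combination hPAB

/-- The products of signed distances from two isogonal conjugates to the two sides through `A`
agree. -/
theorem cross_mul_cross_of_isogonal {A B C P Q : ℂ}
    (h : (2 : ℤ) • ∡ P A B = (2 : ℤ) • ∡ C A Q) :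
    dot (A - C) (A - C) * (cross (B - A) (P - A) * cross (B - A) (Q - A)) =
      dot (B - A) (B - A) * (cross (A - C) (P - C) * cross (A - C) (Q - C)) := by
  have e := cross_mul_dot_of_two_zsmul_oangle_eq h
  have cross_C (X : ℂ) : cross (A - C) (X - C) = cross (A - C) (X - A) := by
    simp only [cross, Complex.sub_re, Complex.sub_im]; ring
  rw [← neg_sub A C] at e
  rw [cross_C, cross_C]
  generalize A - C = c, B - A = b, P - A = p, Q - A = q at e ⊢
  simp only [cross, dot, Complex.neg_re, Complex.neg_im] at e ⊢
  linear_combination (b.re * c.im - b.im * c.re) * e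

theorem slope_eq_of_cospherical {A B C Y Z P : ℂ} {s t : ℝ}
    (hY : Y ∈ line[ℝ, C, A]) (hZ : Z ∈ line[ℝ, A, B]) (hYA : Y ≠ A) (hZA : Z ≠ A)
    (h : Cospherical ({A, Y, Z, P} : Set ℂ))
    (hP₁ : cross (A - C) (P - C) ≠ 0) (hP₂ : cross (B - A) (P - A) ≠ 0)
    (hs : dot (Y - P) (A - C) = s * cross (A - C) (P - C))
    (ht : dot (Z - P) (B - A) = t * cross (B - A) (P - A)) : s = t := by
  have key := cross_mul_dot_self_of_cospherical hY hZ hYA hZA h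
  have hs' : dot (Y - A) (C - A) = dot (P - A) (C - A) - s * cross (A - C) (P - C) := by
    rw [← hs]; simp only [dot, Complex.sub_re, Complex.sub_im]; ring
  have ht' : dot (Z - A) (B - A) = dot (P - A) (B - A) + t * cross (B - A) (P - A) := by
    rw [← ht]; simp only [dot, Complex.sub_re, Complex.sub_im]; ring
  rw [hs', ht'] at key
  apply mul_left_cancel₀ (mul_ne_zero hP₁ hP₂)
  simp only [cross, dot, Complex.sub_re, Complex.sub_im] at key ⊢
  linear_combination key

/-- The image of the midpoint of `PQ` under the spiral similarity `1 + t i` about `P`. -/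
noncomputable def spiralCenter (P Q : ℂ) (t : ℝ) : ℂ :=
  P + (1 + t * Complex.I) * (Q - P) / 2

theorem spiralCenter_swap (P Q : ℂ) (t : ℝ) : spiralCenter Q P (-t) = spiralCenter P Q t := by
  simp only [spiralCenter]; push_cast; ring

theorem dist_sq_spiralCenter {B C X P Q : ℂ} {t : ℝ} (hX : X ∈ line[ℝ, B, C])
    (h : dot (X - P) (C - B) = t * cross (C - B) (P - B)) :
    dot (C - B) (C - B) * dist X (spiralCenter P Q t) ^ 2 = (1 + t ^ 2) *
      (dot (C - B) (C - B) * dot (Q - P) (Q - P) / 4 +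
        cross (C - B) (P - B) * cross (C - B) (Q - B)) := by
  obtain ⟨k, hk1, hk2⟩ := exists_eq_add_of_mem_line hX
  have h' : cross (C - B) (X - P) = -cross (C - B) (P - B) := by
    simp only [cross, Complex.sub_re, Complex.sub_im, hk1, hk2]; ring
  have lagrange : dot (C - B) (C - B) * dist X (spiralCenter P Q t) ^ 2 =
      (dot (X - P) (C - B) - dot (spiralCenter P Q t - P) (C - B)) ^ 2 +
      (cross (C - B) (X - P) - cross (C - B) (spiralCenter P Q t - P)) ^ 2 := by
    rw [Complex.dist_eq, Complex.sq_norm, Complex.normSq_apply]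
    simp only [dot, cross, Complex.sub_re, Complex.sub_im]
    ring
  have hre : (spiralCenter P Q t - P).re = ((Q.re - P.re) - t * (Q.im - P.im)) / 2 := by
    simp [spiralCenter]
  have him : (spiralCenter P Q t - P).im = ((Q.im - P.im) + t * (Q.re - P.re)) / 2 := by
    simp [spiralCenter]
  rw [lagrange, h, h']
  simp only [dot, cross, hre, him]
  simp only [Complex.sub_re, Complex.sub_im]
  ring

theorem slope_neg_of_oangle {B C X Y P Q : ℂ} {t : ℝ} (hX : X ∈ line[ℝ, B, C])
    (hY : Y ∈ line[ℝ, B, C]) (hXY : X ≠ Y) (hP : cross (C - B) (P - B) ≠ 0)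
    (h : dot (X - P) (C - B) = t * cross (C - B) (P - B))
    (hang : (2 : ℤ) • ∡ P X Y = -((2 : ℤ) • ∡ Q Y X)) :
    dot (Y - Q) (C - B) = -t * cross (C - B) (Q - B) := by
  have e := cross_mul_dot_of_two_zsmul_oangle_eq_neg hang
  obtain ⟨k, hk1, hk2⟩ := exists_eq_add_of_mem_line hX
  obtain ⟨l, hl1, hl2⟩ := exists_eq_add_of_mem_line hY
  have hkl : l - k ≠ 0 := by
    intro h0
    rw [sub_eq_zero] at h0
    subst h0
    exact hXY (Complex.ext (by rw [hk1, hl1]) (by rw [hk2, hl2]))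
  have e1 : cross (P - X) (Y - X) = -(l - k) * cross (C - B) (P - B) := by
    simp only [cross, Complex.sub_re, Complex.sub_im, hk1, hk2, hl1, hl2]; ring
  have e2 : dot (P - X) (Y - X) = -(l - k) * (t * cross (C - B) (P - B)) := by
    rw [← h]; simp only [dot, Complex.sub_re, Complex.sub_im, hk1, hk2, hl1, hl2]; ring
  have e3 : cross (Q - Y) (X - Y) = (l - k) * cross (C - B) (Q - B) := by
    simp only [cross, Complex.sub_re, Complex.sub_im, hk1, hk2, hl1, hl2]; ring
  have e4 : dot (Q - Y) (X - Y) = (l - k) * dot (Y - Q) (C - B) := by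
    simp only [dot, Complex.sub_re, Complex.sub_im, hk1, hk2, hl1, hl2]; ring
  rw [e1, e2, e3, e4] at e
  apply mul_left_cancel₀ (mul_ne_zero (mul_ne_zero hkl hkl) hP)
  linear_combination -e

/-- The squared distance from `spiralCenter P Q t` to the points of line `BC` whose join with `P`
makes an angle with the normal to `BC` of tangent `t`. -/
noncomputable def sideRadiusSq (B C P Q : ℂ) (t : ℝ) : ℝ :=
  (1 + t ^ 2) * (dot (Q - P) (Q - P) / 4 +
    cross (C - B) (P - B) * cross (C - B) (Q - B) / dot (C - B) (C - B))

theorem dist_spiralCenter {B C X P Q : ℂ} {t : ℝ} (hBC : C - B ≠ 0) (hX : X ∈ line[ℝ, B, C])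
    (h : dot (X - P) (C - B) = t * cross (C - B) (P - B)) :
    dist X (spiralCenter P Q t) = √(sideRadiusSq B C P Q t) := by
  rw [← Real.sqrt_sq (dist_nonneg (x := X) (y := spiralCenter P Q t))]
  congr 1
  have hN := dot_self_ne_zero hBC
  apply mul_left_cancel₀ hN
  rw [dist_sq_spiralCenter hX h, sideRadiusSq]
  field_simp

theorem sideRadiusSq_swap (B C P Q : ℂ) (t : ℝ) :
    sideRadiusSq B C Q P (-t) = sideRadiusSq B C P Q t := by
  simp only [sideRadiusSq, dot, Complex.sub_re, Complex.sub_im]; ring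

theorem sideRadiusSq_eq_of_isogonal {A B C P Q : ℂ} {t : ℝ} (hAB : B - A ≠ 0) (hCA : A - C ≠ 0)
    (h : (2 : ℤ) • ∡ P A B = (2 : ℤ) • ∡ C A Q) :
    sideRadiusSq A B P Q t = sideRadiusSq C A P Q t := by
  have e := cross_mul_cross_of_isogonal h
  have : cross (B - A) (P - A) * cross (B - A) (Q - A) / dot (B - A) (B - A) =
      cross (A - C) (P - C) * cross (A - C) (Q - C) / dot (A - C) (A - C) := by
    rw [div_eq_div_iff (dot_self_ne_zero hAB) (dot_self_ne_zero hCA)]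
    linear_combination e
  rw [sideRadiusSq, sideRadiusSq, this]

theorem dist_spiralCenter_of_oangle {B C X Y P Q : ℂ} {t : ℝ} (hBC : C - B ≠ 0)
    (hX : X ∈ line[ℝ, B, C]) (hY : Y ∈ line[ℝ, B, C]) (hXY : X ≠ Y)
    (hP : cross (C - B) (P - B) ≠ 0)
    (h : dot (X - P) (C - B) = t * cross (C - B) (P - B))
    (hang : (2 : ℤ) • ∡ P X Y = -((2 : ℤ) • ∡ Q Y X)) :
    dist X (spiralCenter P Q t) = √(sideRadiusSq B C P Q t) ∧
      dist Y (spiralCenter P Q t) = √(sideRadiusSq B C P Q t) := by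
  refine ⟨dist_spiralCenter hBC hX h, ?_⟩
  rw [← spiralCenter_swap, ← sideRadiusSq_swap]
  exact dist_spiralCenter hBC hY (slope_neg_of_oangle hX hY hXY hP h hang)

/- STATEMENT 5: Let P and Q be isogonal conjugates in triangle ABC, let A₁, B₁, C₁ on
BC, CA, AB be such that P is the Miquel point of A₁B₁C₁, and let A₂, B₂, C₂ on
BC, CA, AB satisfy ∡PA₁A₂ = −∡QA₂A₁, ∡PB₁B₂ = −∡QB₂B₁, ∡PC₁C₂ = −∡QC₂C₁
(directed angles mod π, encoded by doubling). Then A₁, A₂, B₁, B₂, C₁, C₂ are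
concyclic.  The plane is modelled by ℂ. -/

theorem six_points_concyclic
    (A B C P Q A₁ A₂ B₁ B₂ C₁ C₂ : ℂ)
    -- triangle ABC is nondegenerate
    (hABC : AffineIndependent ℝ ![A, B, C])
    -- P and Q are isogonal conjugates in ABC
    (hiso₁ : (2 : ℤ) • ∡ P A B = (2 : ℤ) • ∡ C A Q)
    (hiso₂ : (2 : ℤ) • ∡ P B C = (2 : ℤ) • ∡ A B Q)
    (hiso₃ : (2 : ℤ) • ∡ P C A = (2 : ℤ) • ∡ B C Q)
    -- the six points lie on the respective sidelines
    (hA₁ : A₁ ∈ line[ℝ, B, C]) (hA₂ : A₂ ∈ line[ℝ, B, C])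
    (hB₁ : B₁ ∈ line[ℝ, C, A]) (hB₂ : B₂ ∈ line[ℝ, C, A])
    (hC₁ : C₁ ∈ line[ℝ, A, B]) (hC₂ : C₂ ∈ line[ℝ, A, B])
    -- the six points are distinct from each other and from the vertices
    (hdist : List.Pairwise (· ≠ ·) [A, B, C, A₁, A₂, B₁, B₂, C₁, C₂])
    -- P is the Miquel point of A₁B₁C₁ in ABC
    (hP₁ : Cospherical ({A, B₁, C₁, P} : Set ℂ))
    (hP₂ : Cospherical ({B, C₁, A₁, P} : Set ℂ))
    (hP₃ : Cospherical ({C, A₁, B₁, P} : Set ℂ))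
    -- the directed-angle conditions on A₂, B₂, C₂
    (hang₁ : (2 : ℤ) • ∡ P A₁ A₂ = -((2 : ℤ) • ∡ Q A₂ A₁))
    (hang₂ : (2 : ℤ) • ∡ P B₁ B₂ = -((2 : ℤ) • ∡ Q B₂ B₁))
    (hang₃ : (2 : ℤ) • ∡ P C₁ C₂ = -((2 : ℤ) • ∡ Q C₂ C₁)) :
    -- conclusion: the six points lie on one circle
    Concyclic ({A₁, A₂, B₁, B₂, C₁, C₂} : Set ℂ) := by
  simp only [List.pairwise_cons, List.mem_cons, List.not_mem_nil, or_false, forall_eq_or_imp,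
    forall_eq, false_imp_iff, implies_true, List.Pairwise.nil, and_true, ne_eq] at hdist
  obtain ⟨⟨hAB, hAC, hAA₁, hAA₂, hAB₁, hAB₂, hAC₁, hAC₂⟩,
    ⟨hBC, hBA₁, hBA₂, hBB₁, hBB₂, hBC₁, hBC₂⟩, ⟨hCA₁, hCA₂, hCB₁, hCB₂, hCC₁, hCC₂⟩,
    ⟨hA₁A₂, -⟩, -, ⟨hB₁B₂, -⟩, -, hC₁C₂⟩ := hdist
  have tA := cross_ne_zero_of_affineIndependent hABC
  have tB : cross (A - C) (B - C) ≠ 0 := by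
    convert tA using 1; simp only [cross, Complex.sub_re, Complex.sub_im]; ring
  obtain ⟨hPB, hPC⟩ := ne_vertex_of_cospherical tA hB₁ hC₁ (Ne.symm hAB₁) (Ne.symm hAC₁)
    (Ne.symm hCB₁) (Ne.symm hBC₁) hP₁
  obtain ⟨-, hPA⟩ := ne_vertex_of_cospherical tB hC₁ hA₁ (Ne.symm hBC₁) (Ne.symm hBA₁)
    (Ne.symm hAC₁) (Ne.symm hCA₁) hP₂
  have tC : cross (B - A) (C - A) ≠ 0 := by
    convert tA using 1; simp only [cross, Complex.sub_re, Complex.sub_im]; ring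
  have xA := cross_ne_zero_of_isogonal tA hiso₁ hiso₂ hiso₃ hPB hPC
  have xB := cross_ne_zero_of_isogonal tB hiso₂ hiso₃ hiso₁ hPC hPA
  have xC := cross_ne_zero_of_isogonal tC hiso₃ hiso₁ hiso₂ hPA hPB
  obtain ⟨a, ha⟩ : ∃ a, dot (A₁ - P) (C - B) = a * cross (C - B) (P - B) :=
    ⟨_, (div_mul_cancel₀ _ xA).symm⟩
  obtain ⟨b, hb⟩ : ∃ b, dot (B₁ - P) (A - C) = b * cross (A - C) (P - C) :=
    ⟨_, (div_mul_cancel₀ _ xB).symm⟩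
  obtain ⟨c, hc⟩ : ∃ c, dot (C₁ - P) (B - A) = c * cross (B - A) (P - A) :=
    ⟨_, (div_mul_cancel₀ _ xC).symm⟩
  obtain rfl : b = c :=
    slope_eq_of_cospherical hB₁ hC₁ (Ne.symm hAB₁) (Ne.symm hAC₁) hP₁ xB xC hb hc
  obtain rfl : b = a :=
    slope_eq_of_cospherical hC₁ hA₁ (Ne.symm hBC₁) (Ne.symm hBA₁) hP₂ xC xA hc ha
  have nA : C - B ≠ 0 := sub_ne_zero.2 (Ne.symm hBC)
  have nB : A - C ≠ 0 := sub_ne_zero.2 hAC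
  have nC : B - A ≠ 0 := sub_ne_zero.2 (Ne.symm hAB)
  obtain ⟨dA₁, dA₂⟩ := dist_spiralCenter_of_oangle nA hA₁ hA₂ hA₁A₂ xA ha hang₁
  obtain ⟨dB₁, dB₂⟩ := dist_spiralCenter_of_oangle nB hB₁ hB₂ hB₁B₂ xB hb hang₂
  obtain ⟨dC₁, dC₂⟩ := dist_spiralCenter_of_oangle nC hC₁ hC₂ hC₁C₂ xC hc hang₃
  rw [← sideRadiusSq_eq_of_isogonal nC nB hiso₁] at dB₁ dB₂
  rw [sideRadiusSq_eq_of_isogonal nA nC hiso₂] at dA₁ dA₂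
  refine ⟨⟨spiralCenter P Q b, √(sideRadiusSq A B P Q b), ?_⟩,
    coplanar_of_finrank_eq_two _ Complex.finrank_real_complex⟩
  simp only [Set.mem_insert_iff, Set.mem_singleton_iff]
  rintro X (rfl | rfl | rfl | rfl | rfl | rfl) <;> assumption
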